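/- Sparse domination of the dyadic multisublinear maximal operator: Let 0 < r_1,…,r_m < ∞ and set 1/r = Σ_{j=1}^m 1/r_j. For each dyadic grid D on ℝ^n and all functions f_j ∈ L^{r_j}(ℝ^n), there exists a sparse collection S ⊆ D such that pointwise almost everywhere M^D_{(r_1,…,r_m)}(f_1,…,f_m) ≤ 2^{(n+1)/r} Σ_{Q∈S} ( ∏_{j=1}^m ⟨f_j⟩_{r_j,Q} ) χ_{E_Q}, where (E_Q)_{Q∈S} are the pairwise disjoint major subsets of the sparse collection; in particular M^D_{(r_1,…,r_m)}(f_1,…,f_m) ≤ 2^{(n+1)/r} A_{(r_1,…,r_m),S}(f_1,…,f_m) pointwise almost everywhere. -/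

import Mathlib

open MeasureTheory ENNReal

noncomputable section

namespace Paper

/-- An axis-parallel (half-open) cube in `ℝⁿ` with positive side length. -/
def IsCube {n : ℕ} (Q : Set (Fin n → ℝ)) : Prop :=
  ∃ (c : Fin n → ℝ) (h : ℝ), 0 < h ∧
    Q = Set.univ.pi fun i => Set.Ico (c i) (c i + h)

/-- A weight on `ℝⁿ`: a measurable, everywhere positive function. -/
def IsWeight {n : ℕ} (w : (Fin n → ℝ) → ℝ) : Prop :=
  Measurable w ∧ ∀ x, 0 < w x

/-- `expOf ρ` is the exponent `1/ρ ∈ (0,∞]`; `ρ = 0` encodes the exponent `∞`. -/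
def expOf (ρ : ℝ) : ℝ≥0∞ := if ρ = 0 then ∞ else ENNReal.ofReal (1 / ρ)

/-- The average `⟨f⟩_{1/τ, Q}` of a real-valued `f` over `Q`;
`τ = 0` encodes the essential supremum `⟨f⟩_{∞,Q}`. -/
def avg {n : ℕ} (τ : ℝ) (f : (Fin n → ℝ) → ℝ) (Q : Set (Fin n → ℝ)) : ℝ≥0∞ :=
  if τ = 0 then essSup (fun x => ENNReal.ofReal |f x|) (volume.restrict Q)
  else ((volume Q)⁻¹ * ∫⁻ x in Q, ENNReal.ofReal |f x| ^ (1 / τ)) ^ τ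

/-- The average `⟨g⟩_{1/τ, Q}` of an `ℝ≥0∞`-valued `g` over `Q`. -/
def avgE {n : ℕ} (τ : ℝ) (g : (Fin n → ℝ) → ℝ≥0∞) (Q : Set (Fin n → ℝ)) : ℝ≥0∞ :=
  if τ = 0 then essSup g (volume.restrict Q)
  else ((volume Q)⁻¹ * ∫⁻ x in Q, g x ^ (1 / τ)) ^ τ

/-- The weighted norm `‖f‖_{L^{1/ρ}(w^{1/ρ})} = ‖f·w‖_{L^{1/ρ}(ℝⁿ)}`;
`ρ = 0` encodes `p = ∞`. -/
def wnorm {n : ℕ} (ρ : ℝ) (f w : (Fin n → ℝ) → ℝ) : ℝ≥0∞ :=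
  eLpNorm (fun x => f x * w x) (expOf ρ) volume

/-- The weighted norm `‖g·w‖_{L^{1/ρ}}` of an `ℝ≥0∞`-valued function `g`. -/
def wnormE {n : ℕ} (ρ : ℝ) (g : (Fin n → ℝ) → ℝ≥0∞) (w : (Fin n → ℝ) → ℝ) : ℝ≥0∞ :=
  if ρ = 0 then essSup (fun x => g x * ENNReal.ofReal (w x)) volume
  else (∫⁻ x, (g x * ENNReal.ofReal (w x)) ^ (1 / ρ)) ^ ρ

/-- The weak weighted norm `‖f‖_{L^{1/ρ,∞}(w^{1/ρ})}
  = sup_{t>0} t · (∫_{|f|>t} w^{1/ρ})^{ρ}`; `ρ = 0` encodes `p = ∞`. -/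
def wWeakNorm {n : ℕ} (ρ : ℝ) (f w : (Fin n → ℝ) → ℝ) : ℝ≥0∞ :=
  if ρ = 0 then wnorm 0 f w
  else ⨆ t : Set.Ioi (0 : ℝ),
    ENNReal.ofReal t.1 *
      (∫⁻ x in {x | t.1 < |f x|}, ENNReal.ofReal (w x) ^ (1 / ρ)) ^ ρ

/-- The weak weighted norm of an `ℝ≥0∞`-valued function. -/
def wWeakNormE {n : ℕ} (ρ : ℝ) (g : (Fin n → ℝ) → ℝ≥0∞) (w : (Fin n → ℝ) → ℝ) : ℝ≥0∞ :=
  if ρ = 0 then essSup (fun x => g x * ENNReal.ofReal (w x)) volume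
  else ⨆ t : Set.Ioi (0 : ℝ),
    ENNReal.ofReal t.1 *
      (∫⁻ x in {x | ENNReal.ofReal t.1 < g x}, ENNReal.ofReal (w x) ^ (1 / ρ)) ^ ρ

/-- The weak `L¹(ℝⁿ)` quasinorm (with respect to Lebesgue measure) of an
`ℝ≥0∞`-valued function. -/
def weakL1 {n : ℕ} (g : (Fin n → ℝ) → ℝ≥0∞) : ℝ≥0∞ :=
  ⨆ t : Set.Ioi (0 : ℝ), ENNReal.ofReal t.1 * volume {x | ENNReal.ofReal t.1 < g x}

/-- The limited range multilinear weight constant `[w⃗]_{p⃗,(r⃗,s)}`, written in terms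
of the reciprocal exponents `rinv j = 1/r_j`, `pinv j = 1/p_j` and `sinv = 1/s`. -/
def wConst {n m : ℕ} (rinv pinv : Fin m → ℝ) (sinv : ℝ)
    (w : Fin m → (Fin n → ℝ) → ℝ) : ℝ≥0∞ :=
  ⨆ Q : {Q : Set (Fin n → ℝ) // IsCube Q},
    (∏ j, avg (rinv j - pinv j) (fun x => (w j x)⁻¹) Q.1) *
      avg ((∑ j, pinv j) - sinv) (fun x => ∏ j, w j x) Q.1

/-- The symmetric weight constant `[w⃗]_{p⃗,(r⃗,∞)} = sup_Q ∏_j ⟨w_j⁻¹⟩_{1/(1/r_j - 1/p_j),Q}`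
for tuples of weights with `∏_j w_j = 1`. -/
def wConstS {n m : ℕ} (rinv pinv : Fin m → ℝ)
    (w : Fin m → (Fin n → ℝ) → ℝ) : ℝ≥0∞ :=
  ⨆ Q : {Q : Set (Fin n → ℝ) // IsCube Q},
    ∏ j, avg (rinv j - pinv j) (fun x => (w j x)⁻¹) Q.1

/-- The multisublinear Hardy-Littlewood maximal operator
`M_{(r_1,…,r_m)}(f⃗)(x) = sup_{Q ∋ x} ∏_j ⟨f_j⟩_{r_j,Q}` (reciprocal exponents). -/
def maximal {n m : ℕ} (rinv : Fin m → ℝ)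
    (f : Fin m → (Fin n → ℝ) → ℝ) (x : Fin n → ℝ) : ℝ≥0∞ :=
  ⨆ Q : {Q : Set (Fin n → ℝ) // IsCube Q ∧ x ∈ Q}, ∏ j, avg (rinv j) (f j) Q.1

/-- A sparse family of cubes (with sparsity constant 2): to each cube `Q` of the family
is associated a major subset `E Q ⊆ Q` with `|Q| ≤ 2|E Q|`, and these sets are
pairwise disjoint. -/
structure SparseFamily (n : ℕ) where
  cubes : Set (Set (Fin n → ℝ))
  E : Set (Fin n → ℝ) → Set (Fin n → ℝ)
  isCube : ∀ Q ∈ cubes, IsCube Q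
  E_subset : ∀ Q ∈ cubes, E Q ⊆ Q
  E_meas : ∀ Q ∈ cubes, MeasurableSet (E Q)
  E_disj : ∀ Q ∈ cubes, ∀ Q' ∈ cubes, Q ≠ Q' → Disjoint (E Q) (E Q')
  density : ∀ Q ∈ cubes, volume Q ≤ 2 * volume (E Q)

/-- The sparse form `Λ_{r⃗,S}(f⃗) = ∑_{Q∈S} (∏_j ⟨f_j⟩_{r_j,Q}) |Q|`. -/
def sparseForm {n m : ℕ} (rinv : Fin m → ℝ) (S : SparseFamily n)
    (f : Fin m → (Fin n → ℝ) → ℝ) : ℝ≥0∞ :=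
  ∑' Q : S.cubes, (∏ j, avg (rinv j) (f j) Q.1) * volume Q.1

/-- The sparse operator `A_{r⃗,S}(f⃗) = ∑_{Q∈S} (∏_j ⟨f_j⟩_{r_j,Q}) χ_Q`. -/
def sparseOp {n m : ℕ} (rinv : Fin m → ℝ) (S : SparseFamily n)
    (f : Fin m → (Fin n → ℝ) → ℝ) (x : Fin n → ℝ) : ℝ≥0∞ :=
  ∑' Q : S.cubes, (∏ j, avg (rinv j) (f j) Q.1) *
    (Q.1).indicator (fun _ => (1 : ℝ≥0∞)) x

end Paper
namespace Paper

/-- A dyadic cube of generation `k` (side length `2^k`). -/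
def IsDyadicCube {n : ℕ} (k : ℤ) (Q : Set (Fin n → ℝ)) : Prop :=
  ∃ c : Fin n → ℝ, Q = Set.univ.pi fun i => Set.Ico (c i) (c i + 2 ^ k)

/-- A dyadic grid on `ℝⁿ`: a family of dyadic cubes of all generations whose members are
nested or disjoint, and such that every point lies in a cube of every generation. -/
def IsDyadicGrid {n : ℕ} (D : Set (Set (Fin n → ℝ))) : Prop :=
  (∀ Q ∈ D, ∃ k : ℤ, IsDyadicCube k Q) ∧
  (∀ Q ∈ D, ∀ Q' ∈ D, Q ⊆ Q' ∨ Q' ⊆ Q ∨ Disjoint Q Q') ∧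
  (∀ (k : ℤ) (x : Fin n → ℝ), ∃ Q ∈ D, x ∈ Q ∧ IsDyadicCube k Q)

/-- The dyadic multisublinear maximal operator `M^D_{(r_1,…,r_m)}`. -/
def dyadicMaximal {n m : ℕ} (D : Set (Set (Fin n → ℝ))) (rinv : Fin m → ℝ)
    (f : Fin m → (Fin n → ℝ) → ℝ) (x : Fin n → ℝ) : ℝ≥0∞ :=
  ⨆ Q : {Q : Set (Fin n → ℝ) // Q ∈ D ∧ x ∈ Q}, ∏ j, avg (rinv j) (f j) Q.1

/-- `T` is `m`-linear: linear in each coordinate separately. -/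
def IsMLinear {n m : ℕ} (T : (Fin m → (Fin n → ℝ) → ℝ) → (Fin n → ℝ) → ℝ) : Prop :=
  ∀ (f : Fin m → (Fin n → ℝ) → ℝ) (j : Fin m) (c : ℝ) (g g' : (Fin n → ℝ) → ℝ),
    T (Function.update f j (fun x => c * g x + g' x)) =
      fun x => c * T (Function.update f j g) x + T (Function.update f j g') x

/-- `T` is positive-valued and `m`-sublinear: subadditive and positively homogeneous
in each coordinate separately. -/
def IsMSublinearPos {n m : ℕ} (T : (Fin m → (Fin n → ℝ) → ℝ) → (Fin n → ℝ) → ℝ) : Prop :=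
  (∀ f x, 0 ≤ T f x) ∧
  (∀ (f : Fin m → (Fin n → ℝ) → ℝ) (j : Fin m) (g g' : (Fin n → ℝ) → ℝ) (x : Fin n → ℝ),
    T (Function.update f j (fun y => g y + g' y)) x ≤
      T (Function.update f j g) x + T (Function.update f j g') x) ∧
  (∀ (f : Fin m → (Fin n → ℝ) → ℝ) (j : Fin m) (c : ℝ) (g : (Fin n → ℝ) → ℝ)
    (x : Fin n → ℝ), 0 ≤ c →
    T (Function.update f j (fun y => c * g y)) x = c * T (Function.update f j g) x)

/-- A simple function: measurable with finitely many values. -/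
def IsSimpleFn {n : ℕ} (f : (Fin n → ℝ) → ℝ) : Prop :=
  Measurable f ∧ (Set.range f).Finite

/-- A bounded, compactly supported (measurable) function. -/
def BddCompSupp {n : ℕ} (f : (Fin n → ℝ) → ℝ) : Prop :=
  Measurable f ∧ (∃ M : ℝ, ∀ x, |f x| ≤ M) ∧ HasCompactSupport f

/-- The `ℓ^{1/σ}` norm of a sequence; `σ = 0` encodes `ℓ^∞`. -/
def lqNorm (σ : ℝ) (F : ℕ → ℝ) : ℝ≥0∞ :=
  if σ = 0 then ⨆ k, ENNReal.ofReal |F k|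
  else (∑' k, ENNReal.ofReal |F k| ^ (1 / σ)) ^ σ

end Paper
namespace Paper

open Set

section DyadicCubes

variable {n : ℕ}

theorem IsDyadicCube.volume_eq {k : ℤ} {Q : Set (Fin n → ℝ)} (h : IsDyadicCube k Q) :
    volume Q = ENNReal.ofReal (2 ^ k) ^ n := by
  obtain ⟨c, rfl⟩ := h
  simp [Real.volume_pi_Ico]

theorem IsDyadicCube.volume_ne_zero {k : ℤ} {Q : Set (Fin n → ℝ)} (h : IsDyadicCube k Q) :
    volume Q ≠ 0 := by
  rw [h.volume_eq]
  have : (0 : ℝ) < 2 ^ k := by positivity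
  exact pow_ne_zero _ (by simpa using this)

theorem IsDyadicCube.volume_ne_top {k : ℤ} {Q : Set (Fin n → ℝ)} (h : IsDyadicCube k Q) :
    volume Q ≠ ∞ := by
  rw [h.volume_eq]
  exact ENNReal.pow_ne_top ENNReal.ofReal_ne_top

theorem IsDyadicCube.measurableSet {k : ℤ} {Q : Set (Fin n → ℝ)} (h : IsDyadicCube k Q) :
    MeasurableSet Q := by
  obtain ⟨c, rfl⟩ := h
  exact MeasurableSet.univ_pi fun _ => measurableSet_Ico

theorem IsDyadicCube.isCube {k : ℤ} {Q : Set (Fin n → ℝ)} (h : IsDyadicCube k Q) :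
    IsCube Q := by
  obtain ⟨c, rfl⟩ := h
  exact ⟨c, 2 ^ k, by positivity, rfl⟩

theorem IsDyadicCube.nonempty {k : ℤ} {Q : Set (Fin n → ℝ)} (h : IsDyadicCube k Q) :
    Q.Nonempty :=
  nonempty_of_measure_ne_zero h.volume_ne_zero

theorem IsDyadicCube.eq_of_subset {k : ℤ} {Q Q' : Set (Fin n → ℝ)}
    (h : IsDyadicCube k Q) (h' : IsDyadicCube k Q') (hs : Q ⊆ Q') : Q = Q' := by
  have hne := h.nonempty
  obtain ⟨c, rfl⟩ := h
  obtain ⟨c', rfl⟩ := h'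
  have hk : (0 : ℝ) < 2 ^ k := by positivity
  rcases (Set.pi_subset_pi_iff).1 hs with H | H
  · congr! 2 with i
    have := (Set.Ico_subset_Ico_iff (by linarith)).1 (H i (mem_univ i))
    have hc : c i = c' i := by linarith
    rw [hc]
  · exact absurd H hne.ne_empty

theorem IsDyadicCube.generation_le_of_subset (hn : n ≠ 0) {k k' : ℤ} {Q Q' : Set (Fin n → ℝ)}
    (h : IsDyadicCube k Q) (h' : IsDyadicCube k' Q') (hs : Q ⊆ Q') : k ≤ k' := by
  have hv := measure_mono (μ := volume) hs
  rw [h.volume_eq, h'.volume_eq, ENNReal.pow_le_pow_left_iff hn,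
    ENNReal.ofReal_le_ofReal_iff (by positivity)] at hv
  exact (zpow_le_zpow_iff_right₀ (by norm_num)).1 hv

theorem IsDyadicCube.volume_succ {k : ℤ} {Q P : Set (Fin n → ℝ)}
    (h : IsDyadicCube k Q) (h' : IsDyadicCube (k + 1) P) :
    volume P = 2 ^ n * volume Q := by
  rw [h.volume_eq, h'.volume_eq, zpow_add_one₀ (by norm_num), mul_comm,
    ENNReal.ofReal_mul (by norm_num), mul_pow]
  simp

variable {D : Set (Set (Fin n → ℝ))}

theorem IsDyadicGrid.pairwiseDisjoint_generation (hD : IsDyadicGrid D) (k : ℤ) :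
    {Q ∈ D | IsDyadicCube k Q}.PairwiseDisjoint id := by
  intro Q hQ Q' hQ' hne
  rcases hD.2.1 Q hQ.1 Q' hQ'.1 with h | h | h
  · exact absurd (hQ.2.eq_of_subset hQ'.2 h) hne
  · exact absurd (hQ'.2.eq_of_subset hQ.2 h) hne.symm
  · exact h

theorem IsDyadicGrid.countable (hD : IsDyadicGrid D) : D.Countable := by
  have hsub : D ⊆ ⋃ k : ℤ, {Q ∈ D | IsDyadicCube k Q} := fun Q hQ => by
    obtain ⟨k, hk⟩ := hD.1 Q hQ
    exact mem_iUnion.2 ⟨k, hQ, hk⟩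
  refine (countable_iUnion fun k => ?_).mono hsub
  refine Set.PairwiseDisjoint.countable_of_nonempty_interior (s := id)
    (hD.pairwiseDisjoint_generation k) ?_
  rintro Q ⟨-, c, rfl⟩
  have hk : (0 : ℝ) < 2 ^ k := by positivity
  refine ⟨fun i => c i + 2 ^ k / 2, ?_⟩
  simp only [id, interior_pi_set finite_univ, interior_Ico, mem_univ_pi, mem_Ioo]
  intro i
  constructor <;> linarith

/-- In positive dimension every cube of a dyadic grid has a parent. -/
theorem IsDyadicGrid.exists_parent (hn : n ≠ 0) (hD : IsDyadicGrid D) {Q : Set (Fin n → ℝ)}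
    (hQ : Q ∈ D) : ∃ P ∈ D, Q ⊂ P ∧ volume P = 2 ^ n * volume Q := by
  obtain ⟨k, hk⟩ := hD.1 Q hQ
  obtain ⟨x, hx⟩ := hk.nonempty
  obtain ⟨P, hP, hxP, hPk⟩ := hD.2.2 (k + 1) x
  have hPQ : ¬ P ⊆ Q := fun h => by
    have := hPk.generation_le_of_subset hn hk h
    omega
  refine ⟨P, hP, ⟨?_, hPQ⟩, hk.volume_succ hPk⟩
  rcases hD.2.1 Q hQ P hP with h | h | h
  · exact h
  · exact absurd h hPQ
  · exact absurd hxP (disjoint_left.1 h hx)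

end DyadicCubes

section Averages

variable {n m : ℕ} (rinv : Fin m → ℝ) (f : Fin m → (Fin n → ℝ) → ℝ)

/-- The product of averages `∏_j ⟨f_j⟩_{r_j,Q}`. -/
abbrev avgProd (Q : Set (Fin n → ℝ)) : ℝ≥0∞ := ∏ j, avg (rinv j) (f j) Q

/-- The Hölder content `∏_j (∫_U |f_j|^{r_j})^{r/r_j}`, with `1/r = ∑_j 1/r_j`. -/
def holderContent (U : Set (Fin n → ℝ)) : ℝ≥0∞ :=
  ∏ j, (∫⁻ x in U, ENNReal.ofReal |f j x| ^ (1 / rinv j)) ^ (rinv j / ∑ i, rinv i)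

variable {rinv f}

theorem avgProd_rpow_mul_volume (hr : ∀ j, 0 < rinv j) (hρ : 0 < ∑ j, rinv j)
    {Q : Set (Fin n → ℝ)} (h0 : volume Q ≠ 0) (ht : volume Q ≠ ∞) :
    avgProd rinv f Q ^ (1 / ∑ j, rinv j) * volume Q = holderContent rinv f Q := by
  have h1 : ∀ j, avg (rinv j) (f j) Q ^ (1 / ∑ i, rinv i) =
      (volume Q)⁻¹ ^ (rinv j / ∑ i, rinv i) *
      (∫⁻ x in Q, ENNReal.ofReal |f j x| ^ (1 / rinv j)) ^ (rinv j / ∑ i, rinv i) := by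
    intro j
    rw [avg, if_neg (hr j).ne', ← ENNReal.rpow_mul, mul_one_div,
      ENNReal.mul_rpow_of_nonneg _ _ (div_nonneg (hr j).le hρ.le)]
  have hi0 : (volume Q)⁻¹ ≠ 0 := ENNReal.inv_ne_zero.2 ht
  have hit : (volume Q)⁻¹ ≠ ∞ := ENNReal.inv_ne_top.2 h0
  have h2 : ∏ j, (volume Q)⁻¹ ^ (rinv j / ∑ i, rinv i) = (volume Q)⁻¹ := by
    have h3 : ∀ s : Finset (Fin m), ∏ j ∈ s, (volume Q)⁻¹ ^ (rinv j / ∑ i, rinv i) =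
        (volume Q)⁻¹ ^ (∑ j ∈ s, rinv j / ∑ i, rinv i) := by
      intro s
      induction s using Finset.induction_on with
      | empty => simp
      | insert a s ha ih =>
        rw [Finset.prod_insert ha, Finset.sum_insert ha, ih, ENNReal.rpow_add _ _ hi0 hit]
    rw [h3, ← Finset.sum_div, div_self hρ.ne', ENNReal.rpow_one]
  rw [avgProd, ← ENNReal.prod_rpow_of_nonneg (by positivity), Finset.prod_congr rfl fun j _ => h1 j,
    Finset.prod_mul_distrib, h2, mul_right_comm, ENNReal.inv_mul_cancel h0 ht, one_mul,
    holderContent]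

theorem avgProd_le_of_subset (hr : ∀ j, 0 < rinv j) {Q P : Set (Fin n → ℝ)} {c : ℝ≥0∞}
    (hc0 : c ≠ 0) (hct : c ≠ ∞) (hQP : Q ⊆ P) (hv : volume P = c * volume Q) :
    avgProd rinv f Q ≤ c ^ (∑ j, rinv j) * avgProd rinv f P := by
  have h1 : ∀ j, avg (rinv j) (f j) Q ≤ c ^ rinv j * avg (rinv j) (f j) P := by
    intro j
    rw [avg, avg, if_neg (hr j).ne', if_neg (hr j).ne', ← ENNReal.mul_rpow_of_nonneg _ _ (hr j).le]
    refine ENNReal.rpow_le_rpow ?_ (hr j).le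
    rw [hv, ENNReal.mul_inv (Or.inl hc0) (Or.inl hct), ← mul_assoc, ← mul_assoc,
      ENNReal.mul_inv_cancel hc0 hct, one_mul]
    gcongr
  have h2 : ∀ s : Finset (Fin m), ∏ j ∈ s, c ^ rinv j = c ^ (∑ j ∈ s, rinv j) := by
    intro s
    induction s using Finset.induction_on with
    | empty => simp
    | insert a s ha ih =>
      rw [Finset.prod_insert ha, Finset.sum_insert ha, ih, ENNReal.rpow_add _ _ hc0 hct]
  calc avgProd rinv f Q ≤ ∏ j, c ^ rinv j * avg (rinv j) (f j) P :=
        Finset.prod_le_prod' fun j _ => h1 j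
    _ = _ := by rw [Finset.prod_mul_distrib, h2]

theorem holderContent_univ_ne_top (hr : ∀ j, 0 < rinv j)
    (hfL : ∀ j, eLpNorm (f j) (expOf (rinv j)) volume < ∞) :
    holderContent rinv f univ ≠ ∞ := by
  refine ENNReal.prod_ne_top fun j _ => ?_
  refine ENNReal.rpow_ne_top_of_nonneg
    (div_nonneg (hr j).le (Finset.sum_nonneg fun i _ => (hr i).le)) ?_
  have h := hfL j
  have hpos : 0 < 1 / rinv j := one_div_pos.2 (hr j)
  rw [expOf, if_neg (hr j).ne', eLpNorm_lt_top_iff_lintegral_rpow_enorm_lt_top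
    (by simpa using hr j) ENNReal.ofReal_ne_top, ENNReal.toReal_ofReal hpos.le] at h
  simpa [Real.enorm_eq_ofReal_abs] using h.ne

/-- A discrete multilinear weak-type estimate for disjoint families of cubes. -/
theorem rpow_mul_volume_sUnion_le (hr : ∀ j, 0 < rinv j) (hρ : 0 < ∑ j, rinv j)
    {T : Set (Set (Fin n → ℝ))} (hTc : T.Countable) (hTd : T.PairwiseDisjoint id)
    (hTk : ∀ Q ∈ T, ∃ k : ℤ, IsDyadicCube k Q) {t : ℝ≥0∞} (ht : ∀ Q ∈ T, t ≤ avgProd rinv f Q)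
    {U : Set (Fin n → ℝ)} (hU : ∀ Q ∈ T, Q ⊆ U) :
    t ^ (1 / ∑ j, rinv j) * volume (⋃₀ T) ≤ holderContent rinv f U := by
  have hcT : Countable T := hTc.to_subtype
  have hmeas : ∀ Q : T, MeasurableSet (Q : Set (Fin n → ℝ)) := fun Q =>
    (hTk Q Q.2).choose_spec.measurableSet
  have hdisj : Pairwise (Function.onFun Disjoint fun Q : T => (Q : Set (Fin n → ℝ))) :=
    fun Q Q' h => hTd Q.2 Q'.2 (Subtype.coe_injective.ne h)
  let : MeasurableSpace T := ⊤
  calc t ^ (1 / ∑ j, rinv j) * volume (⋃₀ T)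
      = ∑' Q : T, t ^ (1 / ∑ j, rinv j) * volume (Q : Set (Fin n → ℝ)) := by
        rw [ENNReal.tsum_mul_left, sUnion_eq_iUnion, measure_iUnion hdisj hmeas]
    _ ≤ ∑' Q : T, holderContent rinv f Q := by
        refine ENNReal.tsum_le_tsum fun Q => ?_
        obtain ⟨k, hk⟩ := hTk Q Q.2
        rw [← avgProd_rpow_mul_volume hr hρ hk.volume_ne_zero hk.volume_ne_top]
        gcongr
        exact ht Q Q.2
    _ = ∫⁻ Q : T, holderContent rinv f Q ∂Measure.count := by rw [lintegral_count]
    _ ≤ ∏ j, (∫⁻ Q : T, (∫⁻ x in Q, ENNReal.ofReal |f j x| ^ (1 / rinv j)) ∂Measure.count) ^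
          (rinv j / ∑ i, rinv i) := by
        refine ENNReal.lintegral_prod_norm_pow_le _ (fun j _ => measurable_from_top.aemeasurable)
          ?_ fun j _ => div_nonneg (hr j).le hρ.le
        rw [← Finset.sum_div, div_self hρ.ne']
    _ ≤ holderContent rinv f U := by
        refine Finset.prod_le_prod' fun j _ =>
          ENNReal.rpow_le_rpow ?_ (div_nonneg (hr j).le hρ.le)
        rw [lintegral_count, ← lintegral_iUnion hmeas hdisj]
        exact lintegral_mono_set (iUnion_subset fun Q => hU Q Q.2)

end Averages

section Stopping

variable {n m : ℕ} (D : Set (Set (Fin n → ℝ))) (rinv : Fin m → ℝ)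
  (f : Fin m → (Fin n → ℝ) → ℝ)

/-- The maximal cubes of the grid on which the product of averages exceeds `t`. -/
def stoppingCubes (t : ℝ≥0∞) : Set (Set (Fin n → ℝ)) :=
  {Q | Maximal (fun Q => Q ∈ D ∧ t < avgProd rinv f Q) Q}

variable {D rinv f}

theorem stoppingCubes_pairwiseDisjoint (hD : IsDyadicGrid D) (t : ℝ≥0∞) :
    (stoppingCubes D rinv f t).PairwiseDisjoint id := by
  intro Q hQ Q' hQ' hne
  rcases hD.2.1 Q hQ.1.1 Q' hQ'.1.1 with h | h | h
  · exact absurd (subset_antisymm h (hQ.2 hQ'.1 h)) hne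
  · exact absurd (subset_antisymm (hQ'.2 hQ.1 h) h) hne
  · exact h

theorem lt_dyadicMaximal_iff {t : ℝ≥0∞} {x : Fin n → ℝ} :
    t < dyadicMaximal D rinv f x ↔ ∃ Q ∈ D, x ∈ Q ∧ t < avgProd rinv f Q := by
  simp [dyadicMaximal, lt_iSup_iff, and_assoc]

theorem measurable_dyadicMaximal (hD : IsDyadicGrid D) :
    Measurable (dyadicMaximal D rinv f) := by
  refine measurable_of_Ioi fun t => ?_
  have : dyadicMaximal D rinv f ⁻¹' Ioi t = ⋃₀ {Q ∈ D | t < avgProd rinv f Q} := by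
    ext x
    simp only [mem_preimage, mem_Ioi, lt_dyadicMaximal_iff, mem_sUnion, mem_ofPred_eq]
    exact ⟨fun ⟨Q, h, h1, h2⟩ => ⟨Q, ⟨h, h2⟩, h1⟩, fun ⟨Q, ⟨h, h2⟩, h1⟩ => ⟨Q, h, h1, h2⟩⟩
  rw [this]
  exact MeasurableSet.sUnion (hD.countable.mono (sep_subset _ _)) fun Q hQ =>
    (hD.1 Q hQ.1).choose_spec.measurableSet

theorem exists_stoppingCube (hn : n ≠ 0) (hr : ∀ j, 0 < rinv j) (hρ : 0 < ∑ j, rinv j)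
    (hD : IsDyadicGrid D) (hfL : ∀ j, eLpNorm (f j) (expOf (rinv j)) volume < ∞)
    {t : ℝ≥0∞} (ht : t ≠ 0) {Q : Set (Fin n → ℝ)} (hQ : Q ∈ D) (htQ : t < avgProd rinv f Q) :
    ∃ P ∈ stoppingCubes D rinv f t, Q ⊆ P := by
  have hs0 : t ^ (1 / ∑ j, rinv j) ≠ 0 := by
    simp only [ne_eq, ENNReal.rpow_eq_zero_iff, ht, false_and, false_or, not_and, not_lt]
    exact fun _ => by positivity
  have hst : t ^ (1 / ∑ j, rinv j) ≠ ∞ :=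
    ENNReal.rpow_ne_top_of_nonneg (by positivity) htQ.ne_top
  have hCt := holderContent_univ_ne_top hr hfL
  have hbound : ∀ (k : ℤ) (P : Set (Fin n → ℝ)), IsDyadicCube k P → t < avgProd rinv f P →
      ENNReal.ofReal (2 ^ k) ^ n ≤ holderContent rinv f univ / t ^ (1 / ∑ j, rinv j) := by
    intro k P hk hP
    rw [ENNReal.le_div_iff_mul_le (Or.inl hs0) (Or.inl hst), mul_comm, ← hk.volume_eq]
    have := rpow_mul_volume_sUnion_le (rinv := rinv) (f := f) (T := {P}) (t := t) (U := univ)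
      hr hρ (countable_singleton P) (by simp) (by rintro _ rfl; exact ⟨k, hk⟩)
      (by rintro _ rfl; exact hP.le) (by simp)
    simpa using this
  have hCdt : holderContent rinv f univ / t ^ (1 / ∑ j, rinv j) ≠ ∞ := ENNReal.div_ne_top hCt hs0
  obtain ⟨N, hN⟩ := ENNReal.exists_nat_gt hCdt
  have hgen : ∀ (k : ℤ) (P : Set (Fin n → ℝ)), IsDyadicCube k P → t < avgProd rinv f P →
      k ≤ N := by
    intro k P hk hP
    by_contra! hlt
    have h1 : (N : ℝ≥0∞) ≤ ENNReal.ofReal (2 ^ k) := by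
      rw [← ENNReal.ofReal_natCast]
      refine ENNReal.ofReal_le_ofReal ?_
      calc (N : ℝ) ≤ 2 ^ N := by exact_mod_cast Nat.lt_two_pow_self.le
        _ = 2 ^ (N : ℤ) := by simp
        _ ≤ 2 ^ k := zpow_le_zpow_right₀ (by norm_num) hlt.le
    have h2 : (1 : ℝ≥0∞) ≤ ENNReal.ofReal (2 ^ k) := by
      rw [← ENNReal.ofReal_one]
      exact ENNReal.ofReal_le_ofReal (one_le_zpow₀ (by norm_num) (by omega))
    exact absurd ((h1.trans (le_self_pow₀ h2 hn)).trans (hbound k P hk hP)) (not_le.2 hN)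
  obtain ⟨k₀, hk₀⟩ := hD.1 Q hQ
  obtain ⟨k, ⟨P, hP, hPk, hQP, htP⟩, hmax⟩ := Int.exists_greatest_of_bdd
    (P := fun k => ∃ P ∈ D, IsDyadicCube k P ∧ Q ⊆ P ∧ t < avgProd rinv f P)
    ⟨N, fun k ⟨P, _, hk, _, hP⟩ => hgen k P hk hP⟩ ⟨k₀, Q, hQ, hk₀, Subset.rfl, htQ⟩
  refine ⟨P, ⟨⟨hP, htP⟩, ?_⟩, hQP⟩
  intro P' hP' hPP'
  obtain ⟨k', hk'⟩ := hD.1 P' hP'.1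
  have h1 : k' ≤ k := hmax k' ⟨P', hP'.1, hk', hQP.trans hPP', hP'.2⟩
  obtain rfl : k = k' := le_antisymm (hPk.generation_le_of_subset hn hk' hPP') h1
  exact (hPk.eq_of_subset hk' hPP').ge

theorem rpow_mul_volume_dyadicMaximal_le (hn : n ≠ 0) (hr : ∀ j, 0 < rinv j)
    (hρ : 0 < ∑ j, rinv j) (hD : IsDyadicGrid D)
    (hfL : ∀ j, eLpNorm (f j) (expOf (rinv j)) volume < ∞) {t : ℝ≥0∞} (ht : t ≠ 0)
    {U : Set (Fin n → ℝ)}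
    (hU : ∀ P ∈ stoppingCubes D rinv f t, P ⊆ U ∨ Disjoint P U) :
    t ^ (1 / ∑ j, rinv j) * volume {x ∈ U | t < dyadicMaximal D rinv f x} ≤
      holderContent rinv f U := by
  have hsub : {x ∈ U | t < dyadicMaximal D rinv f x} ⊆
      ⋃₀ {P ∈ stoppingCubes D rinv f t | P ⊆ U} := by
    rintro x ⟨hxU, hx⟩
    obtain ⟨Q, hQ, hxQ, htQ⟩ := lt_dyadicMaximal_iff.1 hx
    obtain ⟨P, hP, hQP⟩ := exists_stoppingCube hn hr hρ hD hfL ht hQ htQ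
    refine ⟨P, ⟨hP, (hU P hP).resolve_right fun h => ?_⟩, hQP hxQ⟩
    exact disjoint_left.1 h (hQP hxQ) hxU
  calc t ^ (1 / ∑ j, rinv j) * volume {x ∈ U | t < dyadicMaximal D rinv f x}
      ≤ t ^ (1 / ∑ j, rinv j) * volume (⋃₀ {P ∈ stoppingCubes D rinv f t | P ⊆ U}) := by
        gcongr
    _ ≤ holderContent rinv f U :=
        rpow_mul_volume_sUnion_le hr hρ (hD.countable.mono fun P hP => hP.1.1.1)
          ((stoppingCubes_pairwiseDisjoint hD t).subset (sep_subset _ _))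
          (fun P hP => hD.1 P hP.1.1.1) (fun P hP => hP.1.1.2.le) fun P hP => hP.2

theorem ae_dyadicMaximal_ne_top (hn : n ≠ 0) (hr : ∀ j, 0 < rinv j)
    (hρ : 0 < ∑ j, rinv j) (hD : IsDyadicGrid D)
    (hfL : ∀ j, eLpNorm (f j) (expOf (rinv j)) volume < ∞) :
    ∀ᵐ x, dyadicMaximal D rinv f x ≠ ∞ := by
  have hCt := holderContent_univ_ne_top hr hfL
  rw [ae_iff]
  by_contra hv
  obtain ⟨N, hN⟩ := ENNReal.exists_nat_mul_gt hv hCt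
  have hN0 : (N : ℝ≥0∞) ≠ 0 := by
    rintro h
    simp [h] at hN
  refine absurd hN (not_lt.2 ?_)
  have ht0 : (N : ℝ≥0∞) ^ (∑ j, rinv j) ≠ 0 :=
    (ENNReal.rpow_pos (pos_iff_ne_zero.2 hN0) (ENNReal.natCast_ne_top N)).ne'
  have htt : (N : ℝ≥0∞) ^ (∑ j, rinv j) ≠ ∞ :=
    ENNReal.rpow_ne_top_of_nonneg hρ.le (ENNReal.natCast_ne_top N)
  have h := rpow_mul_volume_dyadicMaximal_le (U := univ) hn hr hρ hD hfL ht0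
    fun _ _ => Or.inl (subset_univ _)
  rw [← ENNReal.rpow_mul, mul_one_div, div_self hρ.ne', ENNReal.rpow_one] at h
  refine le_trans ?_ h
  gcongr
  intro hx
  simp only [ne_eq, not_not] at hx
  simp only [mem_univ, true_and, hx, htt.lt_top]

/-- Inside a cube whose product of averages is small compared to `t`, and none of whose
strict ancestors has product of averages above `t`, the maximal operator is at most `t`
on a major subset. -/
theorem two_mul_volume_dyadicMaximal_le (hn : n ≠ 0) (hr : ∀ j, 0 < rinv j)
    (hρ : 0 < ∑ j, rinv j) (hD : IsDyadicGrid D)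
    (hfL : ∀ j, eLpNorm (f j) (expOf (rinv j)) volume < ∞) {t : ℝ≥0∞} (htt : t ≠ ∞)
    {Q : Set (Fin n → ℝ)} (hQ : Q ∈ D) (hQ0 : avgProd rinv f Q ≠ 0)
    (hQt : 2 ^ (∑ j, rinv j) * avgProd rinv f Q ≤ t)
    (hanc : ∀ P ∈ D, Q ⊂ P → avgProd rinv f P ≤ t) :
    2 * volume {x ∈ Q | t < dyadicMaximal D rinv f x} ≤ volume Q := by
  have h2 : (2 : ℝ≥0∞) ^ (∑ j, rinv j) ≠ 0 :=
    (ENNReal.rpow_pos two_pos ENNReal.ofNat_ne_top).ne'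
  have ht0 : t ≠ 0 := by
    rintro rfl
    simp [h2, hQ0] at hQt
  have hFt : avgProd rinv f Q ≠ ∞ := fun h => by
    rw [h, ENNReal.mul_top h2, top_le_iff] at hQt
    exact htt hQt
  obtain ⟨k, hk⟩ := hD.1 Q hQ
  have hw := rpow_mul_volume_dyadicMaximal_le (t := t) (U := Q) hn hr hρ hD hfL ht0 (by
    intro P hP
    rcases hD.2.1 P hP.1.1 Q hQ with h | h | h
    · exact Or.inl h
    · rcases h.eq_or_ssubset with rfl | h
      · exact Or.inl Subset.rfl
      · exact absurd hP.1.2 (not_lt.2 (hanc P hP.1.1 h))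
    · exact Or.inr h)
  rw [← avgProd_rpow_mul_volume hr hρ hk.volume_ne_zero hk.volume_ne_top] at hw
  have hs : 2 * avgProd rinv f Q ^ (1 / ∑ j, rinv j) ≤ t ^ (1 / ∑ j, rinv j) := by
    have := ENNReal.rpow_le_rpow hQt (z := 1 / ∑ j, rinv j) (by positivity)
    rwa [ENNReal.mul_rpow_of_nonneg _ _ (by positivity), ← ENNReal.rpow_mul, mul_one_div,
      div_self hρ.ne', ENNReal.rpow_one] at this
  have hc0 : avgProd rinv f Q ^ (1 / ∑ j, rinv j) ≠ 0 :=
    (ENNReal.rpow_pos (pos_iff_ne_zero.2 hQ0) hFt).ne'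
  have hct : avgProd rinv f Q ^ (1 / ∑ j, rinv j) ≠ ∞ :=
    ENNReal.rpow_ne_top_of_nonneg (by positivity) hFt
  rw [← ENNReal.mul_le_mul_iff_right hc0 hct]
  refine le_trans ?_ hw
  rw [← mul_assoc, mul_comm _ (2 : ℝ≥0∞)]
  gcongr

end Stopping

section SparseDomination

variable {n m : ℕ} {D : Set (Set (Fin n → ℝ))} {rinv : Fin m → ℝ}
  {f : Fin m → (Fin n → ℝ) → ℝ}

/-- Pointwise domination on the major subset of a single cube implies the sparse bound. -/
theorem le_mul_tsum_indicator (S : SparseFamily n) {x : Fin n → ℝ} {c M : ℝ≥0∞}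
    (h : ∃ Q ∈ S.cubes, x ∈ S.E Q ∧ M ≤ c * avgProd rinv f Q) :
    M ≤ c * ∑' Q : S.cubes, (∏ j, avg (rinv j) (f j) Q.1) *
      (S.E Q.1).indicator (fun _ => (1 : ℝ≥0∞)) x := by
  obtain ⟨Q, hQ, hx, hM⟩ := h
  refine hM.trans (mul_le_mul_right ?_ c)
  refine le_trans ?_ (ENNReal.le_tsum (⟨Q, hQ⟩ : S.cubes))
  simp [indicator_of_mem hx]

theorem tsum_indicator_le_sparseOp (S : SparseFamily n) (x : Fin n → ℝ) :
    ∑' Q : S.cubes, (∏ j, avg (rinv j) (f j) Q.1) *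
      (S.E Q.1).indicator (fun _ => (1 : ℝ≥0∞)) x ≤ sparseOp rinv S f x :=
  ENNReal.tsum_le_tsum fun Q => mul_le_mul_right
    (indicator_le_indicator_of_subset (S.E_subset Q Q.2) (fun _ => zero_le) x) _

theorem exists_sparse_of_disjoint (S : Set (Set (Fin n → ℝ)))
    (hS : ∀ Q ∈ S, ∃ k : ℤ, IsDyadicCube k Q) (hd : S.PairwiseDisjoint id) :
    ∃ T : SparseFamily n, T.cubes = S ∧ T.E = id :=
  ⟨{ cubes := S
     E := id
     isCube := fun Q hQ => (hS Q hQ).choose_spec.isCube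
     E_subset := fun _ _ => Subset.rfl
     E_meas := fun Q hQ => (hS Q hQ).choose_spec.measurableSet
     E_disj := fun _ hQ _ hQ' h => hd hQ hQ' h
     density := fun _ _ => le_mul_of_one_le_left zero_le one_le_two }, rfl, rfl⟩

theorem exists_sparse_of_pos (hn : n ≠ 0) (hr : ∀ j, 0 < rinv j) (hρ : 0 < ∑ j, rinv j)
    (hD : IsDyadicGrid D) (hfL : ∀ j, eLpNorm (f j) (expOf (rinv j)) volume < ∞) :
    ∃ S : SparseFamily n, S.cubes ⊆ D ∧ ∀ᵐ x, dyadicMaximal D rinv f x ≠ 0 →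
      ∃ Q ∈ S.cubes, x ∈ S.E Q ∧ dyadicMaximal D rinv f x ≤
        (2 : ℝ≥0∞) ^ (((n : ℝ) + 1) * ∑ j, rinv j) * avgProd rinv f Q := by
  set a : ℝ≥0∞ := (2 : ℝ≥0∞) ^ (((n : ℝ) + 1) * ∑ j, rinv j) with ha
  have ha1 : 1 < a := ENNReal.one_lt_rpow one_lt_two (by positivity)
  have hat : a ≠ ∞ := ENNReal.rpow_ne_top_of_nonneg (by positivity) ENNReal.ofNat_ne_top
  have ha0 : a ≠ 0 := (zero_lt_one.trans ha1).ne'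
  have hzpos : ∀ k : ℤ, a ^ k ≠ 0 := fun k => (ENNReal.zpow_pos ha0 hat k).ne'
  have hztop : ∀ k : ℤ, a ^ k ≠ ∞ := fun k => (ENNReal.zpow_lt_top ha0 hat k).ne
  have hzlt : ∀ {k l : ℤ}, a ^ k < a ^ l → k + 1 ≤ l := by
    intro k l h
    by_contra! hlt
    exact absurd h (not_lt.2 (ENNReal.zpow_le_of_le ha1.le (by omega)))
  have hzsucc : ∀ k : ℤ, a ^ (k + 1) = a * a ^ k := fun k => by
    rw [ENNReal.zpow_add ha0 hat, zpow_one, mul_comm]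
  have hanc : ∀ {k : ℤ} {Q P : Set (Fin n → ℝ)}, Q ∈ stoppingCubes D rinv f (a ^ k) → P ∈ D →
      Q ⊂ P → avgProd rinv f P ≤ a ^ k := by
    intro k Q P hQ hP hQP
    by_contra! h
    exact hQP.2 (hQ.2 ⟨hP, h⟩ hQP.1)
  let E : Set (Fin n → ℝ) → Set (Fin n → ℝ) := fun Q =>
    {x ∈ Q | ∀ k : ℤ, avgProd rinv f Q ≤ a ^ k → dyadicMaximal D rinv f x ≤ a ^ k}
  have hEdisj : ∀ {k : ℤ} {Q Q' : Set (Fin n → ℝ)}, Q ∈ stoppingCubes D rinv f (a ^ k) →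
      Q' ∈ D → Q ⊂ Q' → Disjoint (E Q) (E Q') := by
    intro k Q Q' hQ hQ' hs
    refine disjoint_left.2 fun x hx hx' => ?_
    exact absurd (lt_dyadicMaximal_iff.2 ⟨Q, hQ.1.1, hx.1, hQ.1.2⟩)
      (not_lt.2 (hx'.2 k (hanc hQ hQ' hs)))
  let S : SparseFamily n :=
    { cubes := ⋃ k : ℤ, stoppingCubes D rinv f (a ^ k)
      E := E
      isCube := by
        intro Q hQ
        obtain ⟨k, hk⟩ := mem_iUnion.1 hQ
        exact (hD.1 Q hk.1.1).choose_spec.isCube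
      E_subset := fun Q _ => sep_subset _ _
      E_meas := by
        intro Q hQ
        obtain ⟨k, hk⟩ := mem_iUnion.1 hQ
        have hM : Measurable (dyadicMaximal D rinv f) := measurable_dyadicMaximal hD
        have hE : E Q = Q ∩ ⋂ l : ℤ,
            {x | avgProd rinv f Q ≤ a ^ l → dyadicMaximal D rinv f x ≤ a ^ l} := by
          ext x
          simp [E]
        rw [hE]
        refine (hD.1 Q hk.1.1).choose_spec.measurableSet.inter
          (MeasurableSet.iInter fun l => ?_)
        by_cases h : avgProd rinv f Q ≤ a ^ l
        · simpa only [h, true_imp_iff] using measurableSet_le hM measurable_const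
        · simp [h]
      E_disj := by
        intro Q hQ Q' hQ' hne
        obtain ⟨k, hk⟩ := mem_iUnion.1 hQ
        obtain ⟨k', hk'⟩ := mem_iUnion.1 hQ'
        rcases hD.2.1 Q hk.1.1 Q' hk'.1.1 with h | h | h
        · exact hEdisj hk hk'.1.1 (h.ssubset_of_ne hne)
        · exact (hEdisj hk' hk.1.1 (h.ssubset_of_ne hne.symm)).symm
        · exact h.mono (sep_subset _ _) (sep_subset _ _)
      density := by
        intro Q hQ
        obtain ⟨k, hk⟩ := mem_iUnion.1 hQ
        obtain ⟨g, hg⟩ := hD.1 Q hk.1.1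
        obtain ⟨P, hP, hQP, hvP⟩ := hD.exists_parent hn hk.1.1
        have hsmall : 2 ^ (∑ j, rinv j) * avgProd rinv f Q ≤ a ^ (k + 1) := by
          have h1 := avgProd_le_of_subset (rinv := rinv) (f := f) hr (c := 2 ^ n) (by simp)
            (by simp) hQP.1 hvP
          calc 2 ^ (∑ j, rinv j) * avgProd rinv f Q
              ≤ 2 ^ (∑ j, rinv j) * ((2 ^ n) ^ (∑ j, rinv j) * a ^ k) := by
                gcongr
                exact h1.trans (mul_le_mul_right (hanc hk hP hQP) _)
            _ = a ^ (k + 1) := by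
                rw [hzsucc, ← mul_assoc, ← ENNReal.mul_rpow_of_nonneg _ _ hρ.le, ← pow_succ', ha,
                  ENNReal.rpow_mul]
                norm_cast
        have hbad := two_mul_volume_dyadicMaximal_le hn hr hρ hD hfL (hztop (k + 1)) hk.1.1
          (pos_of_gt hk.1.2).ne' hsmall fun P hP hQP => (hanc hk hP hQP).trans
            (ENNReal.zpow_le_of_le ha1.le (by omega))
        have hcover : Q ⊆ E Q ∪ {x ∈ Q | a ^ (k + 1) < dyadicMaximal D rinv f x} := by
          intro x hx
          by_cases h : a ^ (k + 1) < dyadicMaximal D rinv f x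
          · exact Or.inr ⟨hx, h⟩
          · refine Or.inl ⟨hx, fun l hl => (not_lt.1 h).trans ?_⟩
            exact ENNReal.zpow_le_of_le ha1.le (hzlt (hk.1.2.trans_le hl))
        have hsum : volume Q ≤ volume (E Q) +
            volume {x ∈ Q | a ^ (k + 1) < dyadicMaximal D rinv f x} :=
          (measure_mono hcover).trans (measure_union_le _ _)
        have htwo : volume Q + volume Q ≤ 2 * volume (E Q) + volume Q :=
          calc volume Q + volume Q = 2 * volume Q := (two_mul _).symm
            _ ≤ 2 * (volume (E Q) +
                volume {x ∈ Q | a ^ (k + 1) < dyadicMaximal D rinv f x}) := by gcongr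
            _ ≤ _ := by
                rw [mul_add]
                gcongr
        exact (ENNReal.add_le_add_iff_right hg.volume_ne_top).1 htwo }
  refine ⟨S, iUnion_subset fun k Q hQ => hQ.1.1, ?_⟩
  filter_upwards [ae_dyadicMaximal_ne_top hn hr hρ hD hfL] with x hxt hx0
  obtain ⟨k, hkl, hku⟩ := ENNReal.exists_mem_Ioc_zpow hx0 hxt ha1 hat
  obtain ⟨Q, hQ, hxQ, hkQ⟩ := lt_dyadicMaximal_iff.1 hkl
  obtain ⟨P, hP, hQP⟩ := exists_stoppingCube hn hr hρ hD hfL (hzpos k) hQ hkQ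
  refine ⟨P, mem_iUnion.2 ⟨k, hP⟩, ⟨hQP hxQ, fun l hl => hku.trans ?_⟩, hku.trans ?_⟩
  · exact ENNReal.zpow_le_of_le ha1.le (hzlt (hP.1.2.trans_le hl))
  · rw [hzsucc]
    gcongr
    exact hP.1.2.le

/-- If the product of averages is the same on all cubes of the grid (as happens for `n = 0` or
`m = 0`), the cubes of generation `0` suffice. -/
theorem exists_sparse_of_avgProd_const (hD : IsDyadicGrid D)
    (hconst : ∀ Q ∈ D, ∀ P ∈ D, avgProd rinv f Q = avgProd rinv f P) :
    ∃ S : SparseFamily n, S.cubes ⊆ D ∧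
      ∀ x, ∃ Q ∈ S.cubes, x ∈ S.E Q ∧ dyadicMaximal D rinv f x ≤ avgProd rinv f Q := by
  obtain ⟨S, hS, hE⟩ := exists_sparse_of_disjoint {Q ∈ D | IsDyadicCube 0 Q}
    (fun Q hQ => ⟨0, hQ.2⟩) (hD.pairwiseDisjoint_generation 0)
  refine ⟨S, hS ▸ sep_subset _ _, fun x => ?_⟩
  obtain ⟨Q, hQ, hxQ, hQ0⟩ := hD.2.2 0 x
  refine ⟨Q, hS ▸ ⟨hQ, hQ0⟩, hE ▸ hxQ, iSup_le fun P => ?_⟩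
  exact (hconst P.1 P.2.1 Q hQ).le

end SparseDomination

end Paper

namespace Paper

/-- **Sparse domination of the dyadic multisublinear maximal operator** (Lemma 2.8).
For every dyadic grid `D` and every tuple `f_j ∈ L^{r_j}(ℝⁿ)` there is a sparse collection
`S ⊆ D` with `M^D_{r⃗}(f⃗) ≤ 2^{(n+1)/r} ∑_{Q∈S} (∏_j ⟨f_j⟩_{r_j,Q}) χ_{E_Q}` a.e.; in
particular `M^D_{r⃗}(f⃗) ≤ 2^{(n+1)/r} A_{r⃗,S}(f⃗)` a.e., where `1/r = ∑_j 1/r_j`. -/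
theorem dyadic_maximal_sparse_domination
    (n m : ℕ) (rinv : Fin m → ℝ) (hr : ∀ j, 0 < rinv j)
    (D : Set (Set (Fin n → ℝ))) (hD : IsDyadicGrid D)
    (f : Fin m → (Fin n → ℝ) → ℝ) (hf : ∀ j, Measurable (f j))
    (hfL : ∀ j, eLpNorm (f j) (expOf (rinv j)) volume < ∞) :
    ∃ S : SparseFamily n, S.cubes ⊆ D ∧
      (∀ᵐ x ∂(volume : Measure (Fin n → ℝ)),
        dyadicMaximal D rinv f x ≤
          (2 : ℝ≥0∞) ^ (((n : ℝ) + 1) * ∑ j, rinv j) *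
            ∑' Q : S.cubes, (∏ j, avg (rinv j) (f j) Q.1) *
              (S.E Q.1).indicator (fun _ => (1 : ℝ≥0∞)) x) ∧
      (∀ᵐ x ∂(volume : Measure (Fin n → ℝ)),
        dyadicMaximal D rinv f x ≤
          (2 : ℝ≥0∞) ^ (((n : ℝ) + 1) * ∑ j, rinv j) * sparseOp rinv S f x) := by
  have key : ∃ S : SparseFamily n, S.cubes ⊆ D ∧ ∀ᵐ x, dyadicMaximal D rinv f x ≠ 0 →
      ∃ Q ∈ S.cubes, x ∈ S.E Q ∧ dyadicMaximal D rinv f x ≤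
        (2 : ℝ≥0∞) ^ (((n : ℝ) + 1) * ∑ j, rinv j) * avgProd rinv f Q := by
    by_cases hconst : ∀ Q ∈ D, ∀ P ∈ D, avgProd rinv f Q = avgProd rinv f P
    · obtain ⟨S, hS, h⟩ := exists_sparse_of_avgProd_const hD hconst
      refine ⟨S, hS, Filter.Eventually.of_forall fun x _ => ?_⟩
      obtain ⟨Q, hQ, hxQ, hle⟩ := h x
      refine ⟨Q, hQ, hxQ, hle.trans (le_mul_of_one_le_left zero_le ?_)⟩
      have hρ : 0 ≤ ∑ j, rinv j := Finset.sum_nonneg fun j _ => (hr j).le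
      simpa using ENNReal.rpow_le_rpow_of_exponent_le (x := 2) one_le_two
        (show 0 ≤ ((n : ℝ) + 1) * ∑ j, rinv j by positivity)
    · have hn : n ≠ 0 := by
        rintro rfl
        refine hconst fun Q hQ P hP => ?_
        obtain ⟨k, hk⟩ := hD.1 Q hQ
        obtain ⟨l, hl⟩ := hD.1 P hP
        rw [Subsingleton.eq_univ_of_nonempty hk.nonempty,
          Subsingleton.eq_univ_of_nonempty hl.nonempty]
      have hm : Nonempty (Fin m) := by
        by_contra h
        rw [not_nonempty_iff] at h
        exact hconst fun Q _ P _ => by simp [avgProd]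
      exact exists_sparse_of_pos hn hr
        (Finset.sum_pos (fun j _ => hr j) Finset.univ_nonempty) hD hfL
  obtain ⟨S, hSD, hS⟩ := key
  have hae : ∀ᵐ x ∂(volume : Measure (Fin n → ℝ)), dyadicMaximal D rinv f x ≤
      (2 : ℝ≥0∞) ^ (((n : ℝ) + 1) * ∑ j, rinv j) *
        ∑' Q : S.cubes, (∏ j, avg (rinv j) (f j) Q.1) *
          (S.E Q.1).indicator (fun _ => (1 : ℝ≥0∞)) x := by
    filter_upwards [hS] with x hx
    by_cases h0 : dyadicMaximal D rinv f x = 0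
    · simp [h0]
    · exact le_mul_tsum_indicator S (hx h0)
  refine ⟨S, hSD, hae, ?_⟩
  filter_upwards [hae] with x hx
  exact hx.trans (mul_le_mul_right (tsum_indicator_le_sparseOp S x) _)

end Paper
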